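/- Let s, σ > 0, h₀ > 0, ψ ∈ C^∞(ℝ^d) with |∂^γ ψ(x)| ≤ C ε^{|γ|} (γ!)^σ e^{-r|x|^{1/σ}} for all γ, ε > 0 and some r > 0 (i.e. ψ ∈ Σ_s^σ), and let a₀(j,·) ∈ C^∞(ℝ^d) for j ∈ ℤ^d satisfy sup_j |∂^α a₀(j,x)| ≤ h₀^{|α|}(α!)^σ B(x) for all α, where B ∈ L^∞_loc. Then f(x) = Σ_j a₀(j,x)ψ(x−j) is smooth and for every c > 1 there is a constant C' with |∂^α f(x)| ≤ C' (c h₀)^{|α|} (α!)^σ B(x) for all α and x. -/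

import Mathlib

open scoped BigOperators

/-- Partial derivative in the `i`-th coordinate direction. -/
noncomputable def pd {d : ℕ} (i : Fin d) (f : (Fin d → ℝ) → ℂ) : (Fin d → ℝ) → ℂ :=
  fun x => fderiv ℝ f x (Pi.single i 1)

/-- `n`-th iterate of the `i`-th partial derivative. -/
noncomputable def pdPow {d : ℕ} (i : Fin d) : ℕ → ((Fin d → ℝ) → ℂ) → ((Fin d → ℝ) → ℂ)
  | 0 => id
  | n + 1 => pd i ∘ pdPow i n

/-- Multi-index partial derivative `∂^α`. -/
noncomputable def mDeriv {d : ℕ} (α : Fin d → ℕ) (f : (Fin d → ℝ) → ℂ) : (Fin d → ℝ) → ℂ :=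
  ((List.finRange d).foldr (fun i g => pdPow i (α i) ∘ g) id) f

open scoped ContDiff

section PartialDerivatives

variable {d : ℕ}

theorem contDiff_pd {f : (Fin d → ℝ) → ℂ} (hf : ContDiff ℝ ∞ f) (i : Fin d) :
    ContDiff ℝ ∞ (pd i f) :=
  (hf.fderiv_right (m := ∞) (by simp)).clm_apply contDiff_const

theorem pd_comm {f : (Fin d → ℝ) → ℂ} (hf : ContDiff ℝ ∞ f) (i k : Fin d) :
    pd i (pd k f) = pd k (pd i f) := by
  have key : ∀ (i k : Fin d) (x : Fin d → ℝ),
      pd i (pd k f) x = fderiv ℝ (fderiv ℝ f) x (Pi.single i 1) (Pi.single k 1) := by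
    intro i k x
    have hd : DifferentiableAt ℝ (fderiv ℝ f) x :=
      ((hf.fderiv_right (m := ∞) (by simp)).differentiable (by simp)) x
    change fderiv ℝ (fun y => fderiv ℝ f y (Pi.single k 1)) x (Pi.single i 1) = _
    rw [fderiv_clm_apply hd (differentiableAt_const _)]
    simp
  ext x
  rw [key, key]
  exact (hf.contDiffAt.isSymmSndFDerivAt
    (by simpa using (WithTop.coe_le_coe.2 le_top : ((2 : ℕ∞) : ℕ∞ω) ≤ ∞))) _ _

theorem pd_add {f g : (Fin d → ℝ) → ℂ} (hf : ContDiff ℝ ∞ f) (hg : ContDiff ℝ ∞ g)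
    (i : Fin d) : pd i (f + g) = pd i f + pd i g := by
  ext x
  simp only [pd, Pi.add_apply]
  rw [fderiv_add (hf.differentiable (by simp) x) (hg.differentiable (by simp) x)]
  simp

theorem pd_mul {f g : (Fin d → ℝ) → ℂ} (hf : ContDiff ℝ ∞ f) (hg : ContDiff ℝ ∞ g)
    (i : Fin d) : pd i (f * g) = pd i f * g + f * pd i g := by
  ext x
  simp only [pd, Pi.add_apply, Pi.mul_apply]
  rw [fderiv_mul (hf.differentiable (by simp) x) (hg.differentiable (by simp) x)]
  simp
  ring

theorem pd_comp_sub (f : (Fin d → ℝ) → ℂ) (v : Fin d → ℝ) (i : Fin d) :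
    pd i (fun x => f (x - v)) = fun x => pd i f (x - v) := by
  ext x
  simp only [pd]
  rw [fderiv_comp_sub]

theorem contDiff_pdPow {f : (Fin d → ℝ) → ℂ} (hf : ContDiff ℝ ∞ f) (i : Fin d) (n : ℕ) :
    ContDiff ℝ ∞ (pdPow i n f) := by
  induction n with
  | zero => exact hf
  | succ n ih => exact contDiff_pd ih i

theorem pdPow_pd {f : (Fin d → ℝ) → ℂ} (hf : ContDiff ℝ ∞ f) (i k : Fin d) (n : ℕ) :
    pdPow k n (pd i f) = pd i (pdPow k n f) := by
  induction n with
  | zero => rfl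
  | succ n ih =>
    change pd k (pdPow k n (pd i f)) = pd i (pd k (pdPow k n f))
    rw [ih, pd_comm (contDiff_pdPow hf k n)]

/-- Iterated partial derivatives along the coordinates in a list, with multiplicities `α`. -/
noncomputable def listDeriv (l : List (Fin d)) (α : Fin d → ℕ) (f : (Fin d → ℝ) → ℂ) :
    (Fin d → ℝ) → ℂ :=
  (l.foldr (fun i g => pdPow i (α i) ∘ g) id) f

theorem contDiff_listDeriv {f : (Fin d → ℝ) → ℂ} (hf : ContDiff ℝ ∞ f)
    (l : List (Fin d)) (α : Fin d → ℕ) : ContDiff ℝ ∞ (listDeriv l α f) := by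
  induction l with
  | nil => exact hf
  | cons k t ih => exact contDiff_pdPow ih k (α k)

theorem listDeriv_pd {f : (Fin d → ℝ) → ℂ} (hf : ContDiff ℝ ∞ f)
    (l : List (Fin d)) (α : Fin d → ℕ) (i : Fin d) :
    listDeriv l α (pd i f) = pd i (listDeriv l α f) := by
  induction l with
  | nil => rfl
  | cons k t ih =>
    change pdPow k (α k) (listDeriv t α (pd i f)) = pd i (pdPow k (α k) (listDeriv t α f))
    rw [ih, pdPow_pd (contDiff_listDeriv hf t α)]

theorem listDeriv_add_single_of_notMem (f : (Fin d → ℝ) → ℂ) (l : List (Fin d))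
    (α : Fin d → ℕ) (i : Fin d) (hi : i ∉ l) :
    listDeriv l (α + Pi.single i 1) f = listDeriv l α f := by
  induction l with
  | nil => rfl
  | cons k t ih =>
    rw [List.mem_cons, not_or] at hi
    change pdPow k ((α + Pi.single i 1 : Fin d → ℕ) k) (listDeriv t (α + Pi.single i 1) f) =
      pdPow k (α k) (listDeriv t α f)
    rw [ih hi.2]
    simp [Pi.single_eq_of_ne (Ne.symm hi.1)]

theorem listDeriv_add_single {f : (Fin d → ℝ) → ℂ} (hf : ContDiff ℝ ∞ f)
    (l : List (Fin d)) (hl : l.Nodup) (α : Fin d → ℕ) (i : Fin d) (hi : i ∈ l) :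
    listDeriv l (α + Pi.single i 1) f = pd i (listDeriv l α f) := by
  induction l with
  | nil => simp at hi
  | cons k t ih =>
    rw [List.nodup_cons] at hl
    change pdPow k ((α + Pi.single i 1 : Fin d → ℕ) k) (listDeriv t (α + Pi.single i 1) f) =
      pd i (pdPow k (α k) (listDeriv t α f))
    by_cases hk : i = k
    · subst hk
      rw [listDeriv_add_single_of_notMem f t α i hl.1]
      simp only [Pi.add_apply, Pi.single_eq_same]
      rfl
    · rw [ih hl.2 ((List.mem_cons.1 hi).resolve_left hk),
        pdPow_pd (contDiff_listDeriv hf t α)]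
      simp [Pi.single_eq_of_ne (Ne.symm hk)]

theorem contDiff_mDeriv {f : (Fin d → ℝ) → ℂ} (hf : ContDiff ℝ ∞ f) (α : Fin d → ℕ) :
    ContDiff ℝ ∞ (mDeriv α f) :=
  contDiff_listDeriv hf _ α

theorem mDeriv_pd {f : (Fin d → ℝ) → ℂ} (hf : ContDiff ℝ ∞ f) (α : Fin d → ℕ) (i : Fin d) :
    mDeriv α (pd i f) = mDeriv (α + Pi.single i 1) f :=
  (listDeriv_pd hf _ α i).trans
    (listDeriv_add_single hf _ (List.nodup_finRange d) α i (List.mem_finRange i)).symm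

theorem pd_mDeriv {f : (Fin d → ℝ) → ℂ} (hf : ContDiff ℝ ∞ f) (α : Fin d → ℕ) (i : Fin d) :
    pd i (mDeriv α f) = mDeriv (α + Pi.single i 1) f :=
  (listDeriv_add_single hf _ (List.nodup_finRange d) α i (List.mem_finRange i)).symm

theorem mDeriv_zero (f : (Fin d → ℝ) → ℂ) : mDeriv 0 f = f := by
  change listDeriv (List.finRange d) 0 f = f
  induction List.finRange d with
  | nil => rfl
  | cons k t ih => exact ih

theorem multiIndex_induction {P : (Fin d → ℕ) → Prop} (zero : P 0)
    (add_single : ∀ α i, P α → P (α + Pi.single i 1)) (α : Fin d → ℕ) : P α := by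
  induction hn : ∑ i, α i generalizing α with
  | zero =>
    have : α = 0 := by
      ext i
      exact (Finset.sum_eq_zero_iff.1 hn) i (Finset.mem_univ i)
    exact this ▸ zero
  | succ n ih =>
    obtain ⟨i, hi⟩ : ∃ i, α i ≠ 0 := by
      by_contra! h
      simp [h] at hn
    have hα : α = (α - Pi.single i 1) + Pi.single i 1 := by
      ext k
      by_cases hk : k = i
      · subst hk
        simp
        omega
      · simp [Pi.single_eq_of_ne hk]
    rw [hα]
    refine add_single _ _ (ih _ ?_)
    rw [hα] at hn
    simp only [Pi.add_apply, Finset.sum_add_distrib, Finset.sum_pi_single',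
      Finset.mem_univ, if_true] at hn
    exact Nat.succ_injective hn

theorem mDeriv_add {f g : (Fin d → ℝ) → ℂ} (hf : ContDiff ℝ ∞ f) (hg : ContDiff ℝ ∞ g)
    (α : Fin d → ℕ) : mDeriv α (f + g) = mDeriv α f + mDeriv α g := by
  induction α using multiIndex_induction with
  | zero => simp only [mDeriv_zero]
  | add_single α i ih =>
    rw [← pd_mDeriv hf, ← pd_mDeriv hg, ← pd_mDeriv (f := f + g) (hf.add hg), ih,
      pd_add (contDiff_mDeriv hf α) (contDiff_mDeriv hg α)]

theorem mDeriv_comp_sub {f : (Fin d → ℝ) → ℂ} (hf : ContDiff ℝ ∞ f) (v : Fin d → ℝ)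
    (α : Fin d → ℕ) : mDeriv α (fun x => f (x - v)) = fun x => mDeriv α f (x - v) := by
  induction α using multiIndex_induction with
  | zero => simp only [mDeriv_zero]
  | add_single α i ih =>
    rw [← pd_mDeriv hf, ← pd_mDeriv (f := fun x => f (x - v))
      (hf.comp (contDiff_id.sub contDiff_const)), ih, pd_comp_sub]

theorem prod_factorial_mul_le (β γ : Fin d → ℕ) :
    (∏ i, ((β i).factorial : ℝ)) * ∏ i, ((γ i).factorial : ℝ) ≤
      ∏ i, (((β + γ) i).factorial : ℝ) := by
  rw [← Finset.prod_mul_distrib]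
  refine Finset.prod_le_prod (fun i _ => by positivity) fun i _ => ?_
  exact_mod_cast Nat.le_of_dvd (Nat.factorial_pos _) (Nat.factorial_mul_factorial_dvd_factorial_add _ _)

/-- Gevrey bounds at a point are submultiplicative, with the constants `h` and `ε` adding up. -/
theorem norm_mDeriv_mul_mDeriv_le {f g : (Fin d → ℝ) → ℂ} (hf : ContDiff ℝ ∞ f)
    (hg : ContDiff ℝ ∞ g) {x : Fin d → ℝ} {σ h ε P Q : ℝ} (hσ : 0 ≤ σ) (hh : 0 ≤ h)
    (hε : 0 ≤ ε) (hP : 0 ≤ P) (hQ : 0 ≤ Q)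
    (hfb : ∀ β : Fin d → ℕ,
      ‖mDeriv β f x‖ ≤ P * h ^ (∑ i, β i) * (∏ i, ((β i).factorial : ℝ)) ^ σ)
    (hgb : ∀ γ : Fin d → ℕ,
      ‖mDeriv γ g x‖ ≤ Q * ε ^ (∑ i, γ i) * (∏ i, ((γ i).factorial : ℝ)) ^ σ)
    (α β γ : Fin d → ℕ) :
    ‖mDeriv α (mDeriv β f * mDeriv γ g) x‖ ≤
      P * Q * (h ^ (∑ i, β i) * ε ^ (∑ i, γ i) * (h + ε) ^ (∑ i, α i)) *
        (∏ i, (((α + β + γ) i).factorial : ℝ)) ^ σ := by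
  induction α using multiIndex_induction generalizing β γ with
  | zero =>
    rw [mDeriv_zero, Pi.mul_apply, norm_mul, zero_add]
    have hle := Real.rpow_le_rpow (by positivity) (prod_factorial_mul_le β γ) hσ
    rw [Real.mul_rpow (by positivity) (by positivity)] at hle
    calc _ ≤ (P * h ^ (∑ i, β i) * (∏ i, ((β i).factorial : ℝ)) ^ σ) *
          (Q * ε ^ (∑ i, γ i) * (∏ i, ((γ i).factorial : ℝ)) ^ σ) :=
          mul_le_mul (hfb β) (hgb γ) (norm_nonneg _) (by positivity)
      _ = P * Q * (h ^ (∑ i, β i) * ε ^ (∑ i, γ i)) *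
          ((∏ i, ((β i).factorial : ℝ)) ^ σ * (∏ i, ((γ i).factorial : ℝ)) ^ σ) := by ring
      _ ≤ _ := by
        simp only [Pi.zero_apply, Finset.sum_const_zero, pow_zero, mul_one]
        gcongr
  | add_single α i ih =>
    have hfs := contDiff_mDeriv hf
    have hgs := contDiff_mDeriv hg
    have e1 : α + (β + Pi.single i 1) + γ = α + Pi.single i 1 + β + γ := by abel
    have e2 : α + β + (γ + Pi.single i 1) = α + Pi.single i 1 + β + γ := by abel
    have hsum : ∀ δ : Fin d → ℕ, ∑ k, (δ + Pi.single i 1 : Fin d → ℕ) k = (∑ k, δ k) + 1 := by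
      intro δ
      simp [Finset.sum_add_distrib]
    have h1 := ih (β + Pi.single i 1) γ
    have h2 := ih β (γ + Pi.single i 1)
    rw [e1, hsum] at h1
    rw [e2, hsum] at h2
    rw [← mDeriv_pd (f := mDeriv β f * mDeriv γ g) ((hfs β).mul (hgs γ)),
      pd_mul (hfs β) (hgs γ), pd_mDeriv hf, pd_mDeriv hg,
      mDeriv_add (f := mDeriv (β + Pi.single i 1) f * mDeriv γ g)
        (g := mDeriv β f * mDeriv (γ + Pi.single i 1) g)
        ((hfs _).mul (hgs _)) ((hfs _).mul (hgs _)), hsum, Pi.add_apply]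
    refine (norm_add_le _ _).trans ((add_le_add h1 h2).trans_eq ?_)
    ring

theorem norm_mDeriv_mul_le {f g : (Fin d → ℝ) → ℂ} (hf : ContDiff ℝ ∞ f)
    (hg : ContDiff ℝ ∞ g) {x : Fin d → ℝ} {σ h ε P Q : ℝ} (hσ : 0 ≤ σ) (hh : 0 ≤ h)
    (hε : 0 ≤ ε) (hP : 0 ≤ P) (hQ : 0 ≤ Q)
    (hfb : ∀ β : Fin d → ℕ,
      ‖mDeriv β f x‖ ≤ P * h ^ (∑ i, β i) * (∏ i, ((β i).factorial : ℝ)) ^ σ)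
    (hgb : ∀ γ : Fin d → ℕ,
      ‖mDeriv γ g x‖ ≤ Q * ε ^ (∑ i, γ i) * (∏ i, ((γ i).factorial : ℝ)) ^ σ)
    (α : Fin d → ℕ) :
    ‖mDeriv α (f * g) x‖ ≤
      P * Q * (h + ε) ^ (∑ i, α i) * (∏ i, ((α i).factorial : ℝ)) ^ σ := by
  simpa [mDeriv_zero] using norm_mDeriv_mul_mDeriv_le hf hg hσ hh hε hP hQ hfb hgb α 0 0

end PartialDerivatives

section Series

variable {d : ℕ} {ι : Type*}

/-- A family of smooth functions all of whose partial derivatives are dominated on every ball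
by a summable family of constants. -/
def SmoothSummable (u : ι → (Fin d → ℝ) → ℂ) : Prop :=
  (∀ j, ContDiff ℝ ∞ (u j)) ∧ ∀ (α : Fin d → ℕ) (R : ℝ), ∃ b : ι → ℝ, Summable b ∧
    ∀ j x, ‖x‖ < R → ‖mDeriv α (u j) x‖ ≤ b j

theorem SmoothSummable.pd {u : ι → (Fin d → ℝ) → ℂ} (hu : SmoothSummable u) (i : Fin d) :
    SmoothSummable fun j => pd i (u j) := by
  refine ⟨fun j => contDiff_pd (hu.1 j) i, fun α R => ?_⟩
  obtain ⟨b, hb, hub⟩ := hu.2 (α + Pi.single i 1) R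
  refine ⟨b, hb, fun j x hx => ?_⟩
  rw [mDeriv_pd (hu.1 j)]
  exact hub j x hx

theorem clm_eq_sum_proj (L : (Fin d → ℝ) →L[ℝ] ℂ) :
    L = ∑ i, (ContinuousLinearMap.proj (R := ℝ) (φ := fun _ : Fin d => ℝ) i).smulRight
      (L (Pi.single i 1)) := by
  ext v
  conv_lhs => rw [← Finset.univ_sum_single v]
  rw [map_sum]
  simp only [_root_.sum_apply, ContinuousLinearMap.smulRight_apply,
    ContinuousLinearMap.proj_apply]
  refine Finset.sum_congr rfl fun i _ => ?_
  rw [← map_smul, ← Pi.single_smul]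
  simp

theorem clm_norm_le_sum (L : (Fin d → ℝ) →L[ℝ] ℂ) : ‖L‖ ≤ ∑ i, ‖L (Pi.single i 1)‖ := by
  refine L.opNorm_le_bound (Finset.sum_nonneg fun _ _ => norm_nonneg _) fun v => ?_
  conv_lhs => rw [clm_eq_sum_proj L]
  simp only [_root_.sum_apply, ContinuousLinearMap.smulRight_apply,
    ContinuousLinearMap.proj_apply]
  rw [Finset.sum_mul]
  refine (norm_sum_le _ _).trans (Finset.sum_le_sum fun i _ => ?_)
  rw [norm_smul, mul_comm]
  gcongr
  exact norm_le_pi_norm v i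

theorem SmoothSummable.summable {u : ι → (Fin d → ℝ) → ℂ} (hu : SmoothSummable u)
    (α : Fin d → ℕ) (x : Fin d → ℝ) : Summable fun j => mDeriv α (u j) x := by
  obtain ⟨b, hb, hub⟩ := hu.2 α (‖x‖ + 1)
  exact .of_norm_bounded hb fun j => hub j x (lt_add_one _)

theorem SmoothSummable.hasFDerivAt_tsum {u : ι → (Fin d → ℝ) → ℂ} (hu : SmoothSummable u)
    (x : Fin d → ℝ) :
    Summable (fun j => fderiv ℝ (u j) x) ∧
    HasFDerivAt (fun y => ∑' j, u j y) (∑' j, fderiv ℝ (u j) x) x := by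
  have hb := fun i => (hu.pd i).2 0 (‖x‖ + 1)
  choose b hbs hub using hb
  have hle : ∀ j y, y ∈ Metric.ball (0 : Fin d → ℝ) (‖x‖ + 1) →
      ‖fderiv ℝ (u j) y‖ ≤ ∑ i, b i j := by
    intro j y hy
    refine (clm_norm_le_sum _).trans (Finset.sum_le_sum fun i _ => ?_)
    have := hub i j y (by simpa using hy)
    rwa [mDeriv_zero] at this
  have hx : x ∈ Metric.ball (0 : Fin d → ℝ) (‖x‖ + 1) := by simp
  have hs : Summable fun j => ∑ i, b i j := summable_sum fun i _ => hbs i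
  refine ⟨.of_norm_bounded hs fun j => hle j x hx,
    hasFDerivAt_tsum_of_isPreconnected hs Metric.isOpen_ball
      (convex_ball _ _).isPreconnected
      (fun j y _ => ((hu.1 j).differentiable (by simp) y).hasFDerivAt) hle hx ?_ hx⟩
  simpa [mDeriv_zero] using hu.summable 0 x

theorem SmoothSummable.pd_tsum {u : ι → (Fin d → ℝ) → ℂ} (hu : SmoothSummable u) (i : Fin d) :
    _root_.pd i (fun x => ∑' j, u j x) = fun x => ∑' j, _root_.pd i (u j) x := by
  ext x
  obtain ⟨hs, hd⟩ := hu.hasFDerivAt_tsum x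
  simp only [_root_.pd]
  rw [hd.fderiv]
  exact (ContinuousLinearMap.apply ℝ ℂ (Pi.single i (1 : ℝ) : Fin d → ℝ)).map_tsum hs

theorem SmoothSummable.contDiff_tsum {u : ι → (Fin d → ℝ) → ℂ} (hu : SmoothSummable u) :
    ContDiff ℝ ∞ fun x => ∑' j, u j x := by
  rw [contDiff_infty]
  intro n
  induction n generalizing u with
  | zero =>
    rw [Nat.cast_zero, contDiff_zero]
    exact continuous_iff_continuousAt.2 fun x => (hu.hasFDerivAt_tsum x).2.continuousAt
  | succ n ih =>
    rw [Nat.cast_succ, contDiff_succ_iff_fderiv_apply]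
    refine ⟨fun x => (hu.hasFDerivAt_tsum x).2.differentiableAt, by simp, fun v => ?_⟩
    have : (fun x => fderiv ℝ (fun x => ∑' j, u j x) x v) =
        fun x => ∑ i, v i • ∑' j, _root_.pd i (u j) x := by
      ext x
      conv_lhs => rw [clm_eq_sum_proj (fderiv ℝ (fun x => ∑' j, u j x) x)]
      simp only [_root_.sum_apply, ContinuousLinearMap.smulRight_apply,
        ContinuousLinearMap.proj_apply]
      exact Finset.sum_congr rfl fun i _ => congrArg (v i • ·) (congrFun (hu.pd_tsum i) x)
    rw [this]
    exact ContDiff.sum fun i _ => (ih (hu.pd i)).const_smul (v i)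

theorem SmoothSummable.mDeriv_tsum {u : ι → (Fin d → ℝ) → ℂ} (hu : SmoothSummable u)
    (α : Fin d → ℕ) :
    mDeriv α (fun x => ∑' j, u j x) = fun x => ∑' j, mDeriv α (u j) x := by
  induction α using multiIndex_induction generalizing u with
  | zero => simp only [mDeriv_zero]
  | add_single α i ih =>
    rw [← mDeriv_pd hu.contDiff_tsum, hu.pd_tsum, ih (hu.pd i)]
    simp only [mDeriv_pd (hu.1 _)]

end Series

section Lattice

theorem exists_one_add_pow_mul_exp_neg_rpow_le (N : ℕ) {r κ : ℝ} (hr : 0 < r) (hκ : 0 < κ) :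
    ∃ K > (0 : ℝ), ∀ u : ℝ, 0 ≤ u → (1 + u) ^ N * Real.exp (-r * u ^ κ) ≤ K := by
  obtain ⟨M, hM⟩ := exists_nat_ge (N / κ)
  rw [div_le_iff₀ hκ] at hM
  refine ⟨2 ^ N * (1 + M.factorial / r ^ M), by positivity, fun u hu => ?_⟩
  have hy : 0 ≤ r * u ^ κ := by positivity
  have hexp : Real.exp (-r * u ^ κ) ≤ 1 := by
    rw [Real.exp_le_one_iff]
    linarith
  have hpow : (u ^ κ) ^ M * Real.exp (-r * u ^ κ) ≤ M.factorial / r ^ M := by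
    have := Real.pow_div_factorial_le_exp (r * u ^ κ) hy M
    rw [neg_mul, Real.exp_neg, ← div_eq_mul_inv, div_le_div_iff₀ (Real.exp_pos _) (by positivity)]
    rw [div_le_iff₀ (by positivity), mul_pow] at this
    linarith
  have hbase : (1 + u) ^ N ≤ 2 ^ N * (1 + (u ^ κ) ^ M) := by
    have hnn : 0 ≤ (u ^ κ) ^ M := by positivity
    rcases le_total u 1 with h | h
    · calc (1 + u) ^ N ≤ 2 ^ N := by gcongr; linarith
        _ ≤ _ := le_mul_of_one_le_right (by positivity) (by linarith)
    · have h1 : u ^ N ≤ (u ^ κ) ^ M := by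
        rw [← Real.rpow_natCast, ← Real.rpow_natCast, ← Real.rpow_mul hu]
        exact Real.rpow_le_rpow_of_exponent_le h (by linarith)
      calc (1 + u) ^ N ≤ (2 * u) ^ N := by gcongr; linarith
        _ = 2 ^ N * u ^ N := mul_pow _ _ _
        _ ≤ _ := by gcongr; linarith
  calc _ ≤ 2 ^ N * (1 + (u ^ κ) ^ M) * Real.exp (-r * u ^ κ) := by gcongr
    _ = 2 ^ N * (Real.exp (-r * u ^ κ) + (u ^ κ) ^ M * Real.exp (-r * u ^ κ)) := by ring
    _ ≤ _ := by gcongr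

theorem summable_inv_one_add_abs_sq : Summable fun n : ℤ => ((1 + |(n : ℝ)|) ^ 2)⁻¹ := by
  have h : Summable fun n : ℕ => ((1 + (n : ℝ)) ^ 2)⁻¹ := by
    have := (summable_nat_add_iff 1).2 (Real.summable_nat_pow_inv.2 (one_lt_two))
    simpa [add_comm] using this
  exact Summable.of_nat_of_neg (by simpa using h) (by simpa using h)

theorem summable_prod_apply {d : ℕ} {ι : Type*} {g : ι → ℝ} (hg0 : ∀ n, 0 ≤ g n)
    (hg : Summable g) : Summable fun j : Fin d → ι => ∏ i, g (j i) := by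
  classical
  refine summable_of_sum_le (c := ∏ _i : Fin d, ∑' n, g n)
    (fun j => Finset.prod_nonneg fun i _ => hg0 _) fun s => ?_
  have hsub : s ⊆ Fintype.piFinset fun i => s.image fun j => j i := by
    intro j hj
    rw [Fintype.mem_piFinset]
    exact fun i => Finset.mem_image_of_mem _ hj
  refine (Finset.sum_le_sum_of_subset_of_nonneg hsub
    fun j _ _ => Finset.prod_nonneg fun i _ => hg0 _).trans ?_
  rw [← Finset.prod_univ_sum]
  exact Finset.prod_le_prod (fun i _ => Finset.sum_nonneg fun _ _ => hg0 _)
    fun i _ => hg.sum_le_tsum _ fun _ _ => hg0 _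

theorem exists_summable_exp_neg_lattice_le (d : ℕ) {r κ : ℝ} (hr : 0 < r) (hκ : 0 < κ)
    {R : ℝ} (hR : 0 ≤ R) : ∃ b : (Fin d → ℤ) → ℝ, Summable b ∧ ∀ j (x : Fin d → ℝ), ‖x‖ ≤ R →
      Real.exp (-r * ‖x - fun i => (j i : ℝ)‖ ^ κ) ≤ b j := by
  obtain ⟨K, hK, hKb⟩ := exists_one_add_pow_mul_exp_neg_rpow_le (2 * d) hr hκ
  refine ⟨fun j => K * (1 + R) ^ (2 * d) * ∏ i, ((1 + |(j i : ℝ)|) ^ 2)⁻¹,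
    (summable_prod_apply (fun n => by positivity) summable_inv_one_add_abs_sq).mul_left _,
    fun j x hx => ?_⟩
  set v : Fin d → ℝ := fun i => (j i : ℝ)
  have hvn : ‖v‖ ≤ R + ‖x - v‖ := by
    have := norm_sub_le x (x - v)
    rw [sub_sub_cancel] at this
    linarith
  have h1 : ∏ i, (1 + |(j i : ℝ)|) ^ 2 ≤ ((1 + R) * (1 + ‖x - v‖)) ^ (2 * d) := by
    have hle : ∀ i ∈ Finset.univ, (1 + |(j i : ℝ)|) ^ 2 ≤ ((1 + R) * (1 + ‖x - v‖)) ^ 2 := by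
      intro i _
      have := norm_le_pi_norm v i
      rw [Real.norm_eq_abs] at this
      have hn := mul_nonneg hR (norm_nonneg (x - v))
      have : 1 + |(j i : ℝ)| ≤ (1 + R) * (1 + ‖x - v‖) := by
        change |(j i : ℝ)| ≤ _ at this
        nlinarith
      gcongr
    refine (Finset.prod_le_prod (fun i _ => by positivity) hle).trans_eq ?_
    simp [pow_mul]
  beta_reduce
  rw [Finset.prod_inv_distrib, ← div_eq_mul_inv, le_div_iff₀ (by positivity)]
  calc _ ≤ Real.exp (-r * ‖x - v‖ ^ κ) * ((1 + R) * (1 + ‖x - v‖)) ^ (2 * d) := by gcongr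
    _ = ((1 + ‖x - v‖) ^ (2 * d) * Real.exp (-r * ‖x - v‖ ^ κ)) * (1 + R) ^ (2 * d) := by
      rw [mul_pow]; ring
    _ ≤ _ := by
      gcongr
      exact hKb _ (norm_nonneg _)

theorem summable_exp_neg_lattice {d : ℕ} {r κ : ℝ} (hr : 0 < r) (hκ : 0 < κ)
    (x : Fin d → ℝ) :
    Summable fun j : Fin d → ℤ => Real.exp (-r * ‖x - fun i => (j i : ℝ)‖ ^ κ) := by
  obtain ⟨b, hb, hle⟩ := exists_summable_exp_neg_lattice_le d hr hκ (norm_nonneg x)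
  exact .of_nonneg_of_le (fun j => (Real.exp_pos _).le) (fun j => hle j x le_rfl) hb

theorem exists_tsum_exp_neg_lattice_le (d : ℕ) {r κ : ℝ} (hr : 0 < r) (hκ : 0 < κ) :
    ∃ S > (0 : ℝ), ∀ x : Fin d → ℝ,
      ∑' j : Fin d → ℤ, Real.exp (-r * ‖x - fun i => (j i : ℝ)‖ ^ κ) ≤ S := by
  obtain ⟨b, hb, hle⟩ := exists_summable_exp_neg_lattice_le d hr hκ zero_le_one
  have hb0 : 0 ≤ ∑' j, b j := tsum_nonneg fun j =>
    (Real.exp_pos _).le.trans (hle j 0 (by simp))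
  refine ⟨∑' j, b j + 1, by linarith, fun x => ?_⟩
  have hfr : ‖fun i => Int.fract (x i)‖ ≤ 1 := by
    rw [pi_norm_le_iff_of_nonneg zero_le_one]
    intro i
    rw [Real.norm_eq_abs, abs_of_nonneg (Int.fract_nonneg _)]
    exact (Int.fract_lt_one _).le
  have heq : ∑' j : Fin d → ℤ, Real.exp (-r * ‖x - fun i => (j i : ℝ)‖ ^ κ) =
      ∑' k : Fin d → ℤ,
        Real.exp (-r * ‖(fun i => Int.fract (x i)) - fun i => (k i : ℝ)‖ ^ κ) := by
    rw [← (Equiv.addRight fun i => ⌊x i⌋).tsum_eq]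
    refine tsum_congr fun k => ?_
    congr 4
    ext i
    simp [← Int.self_sub_floor]
    ring
  rw [heq]
  have := (summable_exp_neg_lattice hr hκ _).tsum_le_tsum (fun k => hle k _ hfr) hb
  linarith

end Lattice

/-- Gevrey bounds of order `σ` on the coefficient functions `a₀(j,·)`,
together with an ultradifferentiable window `ψ ∈ Σ_s^σ`, propagate to the lattice
superposition `f = Σ_j a₀(j,·) ψ(·−j)`, with Gevrey constant arbitrarily close
to `h₀`. -/
theorem gevrey_lattice_superposition
    (d : ℕ) (s σ h₀ : ℝ) (hs : 0 < s) (hσ : 0 < σ) (hh₀ : 0 < h₀)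
    (ψ : (Fin d → ℝ) → ℂ) (hψsm : ContDiff ℝ (⊤ : ℕ∞) ψ)
    (hψ : ∃ r > (0:ℝ), ∀ ε > (0:ℝ), ∃ C > (0:ℝ),
      ∀ (γ : Fin d → ℕ) (x : Fin d → ℝ),
        ‖mDeriv γ ψ x‖ ≤ C * ε ^ (∑ i, γ i) * (∏ i, ((γ i).factorial : ℝ)) ^ σ *
          Real.exp (-r * ‖x‖ ^ (1 / σ)))
    (a₀ : (Fin d → ℤ) → (Fin d → ℝ) → ℂ)
    (ha₀sm : ∀ j, ContDiff ℝ (⊤ : ℕ∞) (a₀ j))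
    (B : (Fin d → ℝ) → ℝ) (hB_nonneg : ∀ x, 0 ≤ B x)
    (hBloc : ∀ K : Set (Fin d → ℝ), IsCompact K → ∃ M : ℝ, ∀ x ∈ K, B x ≤ M)
    (ha₀ : ∀ (α : Fin d → ℕ) (j : Fin d → ℤ) (x : Fin d → ℝ),
      ‖mDeriv α (a₀ j) x‖ ≤
        h₀ ^ (∑ i, α i) * (∏ i, ((α i).factorial : ℝ)) ^ σ * B x)
    (f : (Fin d → ℝ) → ℂ)
    (hf : ∀ x, f x = ∑' j : Fin d → ℤ, a₀ j x * ψ (x - fun i => (j i : ℝ))) :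
    ContDiff ℝ (⊤ : ℕ∞) f ∧
      ∀ c > (1:ℝ), ∃ C' > (0:ℝ), ∀ (α : Fin d → ℕ) (x : Fin d → ℝ),
        ‖mDeriv α f x‖ ≤
          C' * (c * h₀) ^ (∑ i, α i) * (∏ i, ((α i).factorial : ℝ)) ^ σ * B x := by
  obtain ⟨r, hr, hψ⟩ := hψ
  have hκ : 0 < 1 / σ := by positivity
  set v : (Fin d → ℤ) → Fin d → ℝ := fun j i => (j i : ℝ)
  set u : (Fin d → ℤ) → (Fin d → ℝ) → ℂ := fun j => a₀ j * fun x => ψ (x - v j)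
  have hψt : ∀ j, ContDiff ℝ ∞ fun x => ψ (x - v j) := fun j =>
    hψsm.comp (contDiff_id.sub contDiff_const)
  have hbound : ∀ ε > (0 : ℝ), ∃ C > (0 : ℝ), ∀ α j x, ‖mDeriv α (u j) x‖ ≤
      C * (h₀ + ε) ^ (∑ i, α i) * (∏ i, ((α i).factorial : ℝ)) ^ σ * B x *
        Real.exp (-r * ‖x - v j‖ ^ (1 / σ)) := by
    intro ε hε
    obtain ⟨C, hC, hCb⟩ := hψ ε hε
    refine ⟨C, hC, fun α j x => ?_⟩
    refine (norm_mDeriv_mul_le (P := B x) (Q := C * Real.exp (-r * ‖x - v j‖ ^ (1 / σ)))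
      (ha₀sm j) (hψt j) hσ.le hh₀.le hε.le (hB_nonneg x) (by positivity)
      (fun β => (ha₀ β j x).trans_eq (by ring)) (fun γ => ?_) α).trans_eq (by ring)
    rw [mDeriv_comp_sub hψsm]
    exact (hCb γ (x - v j)).trans_eq (by ring)
  have hus : SmoothSummable u := by
    refine ⟨fun j => (ha₀sm j).mul (hψt j), fun α R => ?_⟩
    obtain ⟨C, hC, hCb⟩ := hbound 1 one_pos
    obtain ⟨M, hM⟩ := hBloc _ (isCompact_closedBall (0 : Fin d → ℝ) |R|)
    obtain ⟨b, hb, hle⟩ := exists_summable_exp_neg_lattice_le d hr hκ (abs_nonneg R)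
    refine ⟨_, hb.mul_left
      (C * (h₀ + 1) ^ (∑ i, α i) * (∏ i, ((α i).factorial : ℝ)) ^ σ * M), fun j x hx => ?_⟩
    have hxR : ‖x‖ ≤ |R| := hx.le.trans (le_abs_self R)
    have hBM : B x ≤ M := hM x (by simpa using hxR)
    have hM0 : 0 ≤ M := (hB_nonneg x).trans hBM
    refine (hCb α j x).trans ?_
    gcongr
    exact hle j x hxR
  have hfu : f = fun x => ∑' j, u j x := funext hf
  refine ⟨hfu ▸ hus.contDiff_tsum, fun c hc => ?_⟩
  obtain ⟨C, hC, hCb⟩ := hbound ((c - 1) * h₀) (mul_pos (by linarith) hh₀)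
  obtain ⟨S, hS, hSb⟩ := exists_tsum_exp_neg_lattice_le d hr hκ
  have hch : h₀ + (c - 1) * h₀ = c * h₀ := by ring
  rw [hch] at hCb
  refine ⟨C * S, by positivity, fun α x => ?_⟩
  have hnn : 0 ≤ C * (c * h₀) ^ (∑ i, α i) * (∏ i, ((α i).factorial : ℝ)) ^ σ * B x := by
    have := hB_nonneg x
    positivity
  rw [hfu, hus.mDeriv_tsum]
  refine (tsum_of_norm_bounded
    ((summable_exp_neg_lattice hr hκ x).mul_left _).hasSum fun j => hCb α j x).trans ?_
  rw [tsum_mul_left]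
  exact (mul_le_mul_of_nonneg_left (hSb x) hnn).trans_eq (by ring)
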